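/- arXiv:2402.02531 — 5 statements merged into one kernel-verified Lean document; each statement's English description precedes it below -/
import Mathlib

section
/- Weak maximum principle for the degenerate parabolic operator: Let D_T ⊆ (0,d0) × (0,T] be a nonempty bounded set of the form D_T = U ∩ (ℝ × (-∞, T]) for some open set U ⊆ ℝ². Suppose v is of class C^{2,1} on D_T, is continuous on the closure of D_T, and satisfies (Lv)(x,t) ≤ 0 for all (x,t) ∈ D_T. Then v attains its maximum over the closure of D_T at some point of (closure of D_T) \ D_T (the parabolic boundary). -/
open Set

open Filter Topology

theorem IsLocalMax.second_hasDerivAt_nonpos {f f' : ℝ → ℝ} {x c : ℝ} (hmax : IsLocalMax f x)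
    (hf : ∀ᶠ y in 𝓝 x, HasDerivAt f (f' y) y) (hf' : HasDerivAt f' c x) : c ≤ 0 := by
  by_contra! hc
  have hderiv : deriv f =ᶠ[𝓝 x] f' := hf.mono fun y hy => hy.deriv
  have hdd : deriv (deriv f) x = c := by rw [hderiv.deriv_eq, hf'.deriv]
  have hmin : IsLocalMin f x :=
    isLocalMin_of_deriv_deriv_pos (hdd ▸ hc) hmax.deriv_eq_zero hf.self_of_nhds.continuousAt
  have hconst : f =ᶠ[𝓝 x] fun _ => f x := by
    filter_upwards [hmax, hmin] with y h₁ h₂ using le_antisymm h₁ h₂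
  have hzero : deriv (deriv f) x = 0 := by
    rw [hconst.deriv.deriv_eq]
    simp
  linarith

theorem HasDerivWithinAt.nonneg_of_eventually_le_left {f : ℝ → ℝ} {t c : ℝ}
    (hf : HasDerivWithinAt f c (Iic t) t) (hmax : ∀ᶠ s in 𝓝[<] t, f s ≤ f t) : 0 ≤ c := by
  have hlim := (hasDerivWithinAt_iff_tendsto_slope' self_notMem_Iio).1
    (hf.mono Iio_subset_Iic_self)
  refine ge_of_tendsto hlim ?_
  filter_upwards [hmax, self_mem_nhdsWithin] with s hs hst
  rw [slope_def_field]
  exact div_nonneg_of_nonpos (sub_nonpos.2 hs) (sub_nonpos.2 (le_of_lt hst))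

/-- Weak maximum principle for the degenerate parabolic operator
    `(Lv)(x,t) = n0(x) vₜ(x,t) - a(x,t) vₓₓ(x,t) - b(x,t) vₓ(x,t)`:
    if `Lv ≤ 0` on a set `D_T ⊆ (0,d0) × (0,T]` of the form `U ∩ {t ≤ T}` with `U` open,
    then `v` attains its maximum over `closure D_T` on the parabolic boundary
    `closure D_T \ D_T`. -/
theorem weak_maximum_principle_degenerate_parabolic
    (B m d0 T : ℝ)
    (hB : 0 < B) (hm : 0 < m) (hd0 : d0 ∈ Set.Ioo (0:ℝ) 1) (hT : 0 < T)
    (n0 : ℝ → ℝ) (hn0cont : Continuous n0)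
    (hn0 : ∀ x ∈ Set.Icc (0:ℝ) d0, 0 ≤ n0 x ∧ n0 x ≤ m)
    (a b : ℝ → ℝ → ℝ)
    (hacont : ContinuousOn (fun p : ℝ × ℝ => a p.1 p.2) (Set.Icc 0 d0 ×ˢ Set.Icc 0 T))
    (hbcont : ContinuousOn (fun p : ℝ × ℝ => b p.1 p.2) (Set.Icc 0 d0 ×ˢ Set.Icc 0 T))
    (ha : ∀ x ∈ Set.Icc (0:ℝ) d0, ∀ t ∈ Set.Icc (0:ℝ) T,
      1/(2*B) ≤ a x t ∧ a x t ≤ 2*B)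
    (hb : ∀ x ∈ Set.Icc (0:ℝ) d0, ∀ t ∈ Set.Icc (0:ℝ) T, |b x t| ≤ 8*B*(m+1))
    (U : Set (ℝ × ℝ)) (hU : IsOpen U)
    (DT : Set (ℝ × ℝ)) (hDTdef : DT = U ∩ {p : ℝ × ℝ | p.2 ≤ T})
    (hDTsub : DT ⊆ Set.Ioo (0:ℝ) d0 ×ˢ Set.Ioc (0:ℝ) T)
    (hDTne : DT.Nonempty) (hDTbdd : Bornology.IsBounded DT)
    (v vx vxx vt : ℝ → ℝ → ℝ)
    (hvx : ∀ p ∈ DT, HasDerivAt (fun y => v y p.2) (vx p.1 p.2) p.1)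
    (hvxx : ∀ p ∈ DT, HasDerivAt (fun y => vx y p.2) (vxx p.1 p.2) p.1)
    (hvt : ∀ p ∈ DT, HasDerivWithinAt (fun s => v p.1 s) (vt p.1 p.2) (Set.Iic T) p.2)
    (hvxcont : ContinuousOn (fun p : ℝ × ℝ => vx p.1 p.2) DT)
    (hvxxcont : ContinuousOn (fun p : ℝ × ℝ => vxx p.1 p.2) DT)
    (hvtcont : ContinuousOn (fun p : ℝ × ℝ => vt p.1 p.2) DT)
    (hvcont : ContinuousOn (fun p : ℝ × ℝ => v p.1 p.2) (closure DT))
    (hLv : ∀ p ∈ DT,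
      n0 p.1 * vt p.1 p.2 - a p.1 p.2 * vxx p.1 p.2 - b p.1 p.2 * vx p.1 p.2 ≤ 0) :
    ∃ p ∈ closure DT \ DT, ∀ q ∈ closure DT, v q.1 q.2 ≤ v p.1 p.2 := by
  set l : ℝ := 16 * B ^ 2 * (m + 1) + 1 with hl
  have hl0 : 0 < l := by positivity
  have hcpt : IsCompact (closure DT) := hDTbdd.isCompact_closure
  have hclT : closure DT ⊆ {p : ℝ × ℝ | p.2 ≤ T} :=
    closure_minimal (fun p hp => (hDTsub hp).2.2) (isClosed_le continuous_snd continuous_const)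
  have hcld : closure DT ⊆ {p : ℝ × ℝ | p.1 ≤ d0} :=
    closure_minimal (fun p hp => (hDTsub hp).1.2.le) (isClosed_le continuous_fst continuous_const)
  have hbdry : closure DT \ DT = closure DT \ U := by
    ext p
    constructor
    · rintro ⟨h₁, h₂⟩
      exact ⟨h₁, fun hU' => h₂ (hDTdef ▸ ⟨hU', hclT h₁⟩)⟩
    · rintro ⟨h₁, h₂⟩
      exact ⟨h₁, fun h => h₂ (hDTdef ▸ h : p ∈ U ∩ {p : ℝ × ℝ | p.2 ≤ T}).1⟩
  have hbdryCpt : IsCompact (closure DT \ DT) := hbdry ▸ hcpt.diff hU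
  -- the perturbation of `v` by a small multiple of `exp (l * x)` is maximal on the boundary
  have hpert : ∀ ε > 0, ∃ p ∈ closure DT \ DT, ∀ q ∈ closure DT,
      v q.1 q.2 + ε * Real.exp (l * q.1) ≤ v p.1 p.2 + ε * Real.exp (l * p.1) := by
    intro ε hε
    obtain ⟨p, hp, hpmax⟩ := hcpt.exists_isMaxOn (f := fun q : ℝ × ℝ =>
      v q.1 q.2 + ε * Real.exp (l * q.1)) hDTne.closure (hvcont.add (by fun_prop))
    refine ⟨p, ⟨hp, fun hpD => ?_⟩, fun q hq => hpmax hq⟩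
    have hpU : U ∈ 𝓝 (p.1, p.2) :=
      hU.mem_nhds (hDTdef ▸ hpD : p ∈ U ∩ {p : ℝ × ℝ | p.2 ≤ T}).1
    obtain ⟨hpx, hpt⟩ := hDTsub hpD
    have hnearx : ∀ᶠ y in 𝓝 p.1, (y, p.2) ∈ DT := by
      have hc : ContinuousAt (fun y : ℝ => (y, p.2)) p.1 := by fun_prop
      filter_upwards [hc.preimage_mem_nhds hpU] with y hy
      exact hDTdef ▸ ⟨hy, hpt.2⟩
    have hneart : ∀ᶠ s in 𝓝[<] p.2, (p.1, s) ∈ DT := by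
      have hc : ContinuousAt (fun s : ℝ => (p.1, s)) p.2 := by fun_prop
      filter_upwards [mem_nhdsWithin_of_mem_nhds (hc.preimage_mem_nhds hpU),
        self_mem_nhdsWithin] with s hs hst
      exact hDTdef ▸ ⟨hs, (le_of_lt hst).trans hpt.2⟩
    have hexp : ∀ y, HasDerivAt (fun y => Real.exp (l * y)) (l * Real.exp (l * y)) y := by
      intro y
      have h := ((hasDerivAt_id y).const_mul l).exp
      simp only [id, mul_one] at h
      rwa [mul_comm l (Real.exp _)]
    have hmaxx : IsLocalMax (fun y => v y p.2 + ε * Real.exp (l * y)) p.1 := by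
      filter_upwards [hnearx] with y hy using hpmax (subset_closure hy)
    have hdx : ∀ᶠ y in 𝓝 p.1, HasDerivAt (fun y => v y p.2 + ε * Real.exp (l * y))
        (vx y p.2 + ε * (l * Real.exp (l * y))) y := by
      filter_upwards [hnearx] with y hy using (hvx _ hy).add ((hexp y).const_mul ε)
    have hx0 := hmaxx.hasDerivAt_eq_zero hdx.self_of_nhds
    have hxx0 := hmaxx.second_hasDerivAt_nonpos hdx
      ((hvxx p hpD).add (((hexp p.1).const_mul l).const_mul ε))
    have ht0 : 0 ≤ vt p.1 p.2 := by
      refine ((hvt p hpD).mono (Iic_subset_Iic.2 hpt.2)).nonneg_of_eventually_le_left ?_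
      filter_upwards [hneart] with s hs
      simpa using hpmax (subset_closure hs)
    have hxI := Ioo_subset_Icc_self hpx
    have htI := Ioc_subset_Icc_self hpt
    have hn := (hn0 _ hxI).1
    have ha₀ := (ha _ hxI _ htI).1
    have hb₀ := neg_le_of_abs_le (hb _ hxI _ htI)
    have hapos : 0 < a p.1 p.2 := lt_of_lt_of_le (by positivity) ha₀
    have hdom : 0 < a p.1 p.2 * l + b p.1 p.2 := by
      have h₁ : 1 / (2 * B) * l ≤ a p.1 p.2 * l := by gcongr
      have h₂ : 1 / (2 * B) * l = 8 * B * (m + 1) + 1 / (2 * B) := by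
        rw [hl]
        field_simp
        ring
      have h₃ : 0 < 1 / (2 * B) := by positivity
      linarith
    have hL := hLv p hpD
    have h₁ := mul_nonneg hn ht0
    have h₂ := mul_nonneg hapos.le (neg_nonneg.2 hxx0)
    have h₃ : 0 < ε * l * Real.exp (l * p.1) * (a p.1 p.2 * l + b p.1 p.2) := by positivity
    have h₄ : vx p.1 p.2 = -(ε * (l * Real.exp (l * p.1))) := by linarith
    rw [h₄] at hL
    nlinarith
  obtain ⟨p₁, hp₁, -⟩ := hpert 1 one_pos
  obtain ⟨p, hp, hpmax⟩ := hbdryCpt.exists_isMaxOn ⟨p₁, hp₁⟩ (hvcont.mono sdiff_subset)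
  refine ⟨p, hp, fun q hq => le_of_forall_pos_le_add fun δ hδ => ?_⟩
  obtain ⟨r, hr, hrmax⟩ := hpert (δ / Real.exp (l * d0)) (by positivity)
  have h₁ := hrmax q hq
  have h₂ : v r.1 r.2 ≤ v p.1 p.2 := hpmax hr
  have h₃ : δ / Real.exp (l * d0) * Real.exp (l * r.1) ≤ δ := by
    have hrd : r.1 ≤ d0 := hcld hr.1
    calc δ / Real.exp (l * d0) * Real.exp (l * r.1)
        ≤ δ / Real.exp (l * d0) * Real.exp (l * d0) := by gcongr
      _ = δ := div_mul_cancel₀ _ (Real.exp_ne_zero _)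
  have h₄ : 0 < δ / Real.exp (l * d0) * Real.exp (l * q.1) := by positivity
  linarith
end

section
/- Hopf's lemma for the degenerate parabolic operator: Let ℓ ∈ (0,d0) and t0 ∈ (3ℓ²/4, T], and set D_T := {(x,t) ∈ ℝ² : (x−ℓ)² + (t0−t) < ℓ², 0 < x < ℓ/2, 0 < t ≤ t0}. Suppose v is of class C^{2,1} on (0,d0) × (0,T], is continuous on [0,d0] × [0,T], satisfies (Lv)(x,t) ≤ 0 for all (x,t) ∈ D_T, and satisfies v(x,t) < v(0,t0) for all (x,t) ∈ D_T. If the one-sided derivative ∂ₓ⁺v(0,t0) := lim_{h→0⁺} (v(h,t0) − v(0,t0))/h exists, then ∂ₓ⁺v(0,t0) < 0; equivalently, the derivative of v at (0,t0) in the direction of the outer unit normal (−1,0) is strictly positive. -/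
open Set

/-- Second derivative test: at a local maximum the second derivative is nonpositive. -/
lemma IsLocalMax.second_deriv_nonpos {f f' : ℝ → ℝ} {x f'' : ℝ} (hmax : IsLocalMax f x)
    (hf : ∀ᶠ y in nhds x, HasDerivAt f (f' y) y) (hf' : HasDerivAt f' f'' x) : f'' ≤ 0 := by
  by_contra! hpos
  have hderiv : deriv f =ᶠ[nhds x] f' := hf.mono fun y hy => hy.deriv
  have hderiv2 : deriv (deriv f) x = f'' := by rw [hderiv.deriv_eq, hf'.deriv]
  have hmin : IsLocalMin f x :=
    isLocalMin_of_deriv_deriv_pos (by rwa [hderiv2]) hmax.deriv_eq_zero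
      hf.self_of_nhds.continuousAt
  have hconst : f =ᶠ[nhds x] fun _ => f x := by
    filter_upwards [hmax, hmin] with y h1 h2 using le_antisymm h1 h2
  have hzero : deriv (deriv f) x = 0 := by
    rw [hconst.deriv.deriv_eq]
    simp
  linarith

/-- A function that attains a left-sided local maximum has nonnegative left derivative there. -/
lemma HasDerivWithinAt.nonneg_of_isLocalMaxOn_Iic {f : ℝ → ℝ} {f' t : ℝ}
    (hf : HasDerivWithinAt f f' (Iic t) t) (hmax : IsLocalMaxOn f (Iic t) t) : 0 ≤ f' := by
  have hlim := (hasDerivWithinAt_iff_tendsto_slope' self_notMem_Iio).1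
    (hf.mono Iio_subset_Iic_self)
  refine ge_of_tendsto hlim ?_
  filter_upwards [hmax.filter_mono (nhdsWithin_mono t Iio_subset_Iic_self), self_mem_nhdsWithin]
    with s hs hst
  rw [slope_def_field]
  exact div_nonneg_of_nonpos (sub_nonpos.2 hs) (sub_nonpos.2 (le_of_lt hst))

/-- Hopf's lemma for the degenerate parabolic operator
    `(Lv)(x,t) = n0(x) vₜ(x,t) - a(x,t) vₓₓ(x,t) - b(x,t) vₓ(x,t)`:
    on `D_T = {(x,t) : (x-ℓ)² + (t0-t) < ℓ², 0 < x < ℓ/2, 0 < t ≤ t0}`, if `Lv ≤ 0` and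
    `v < v(0,t0)` on `D_T`, then the one-sided spatial derivative of `v` at `(0,t0)` is
    strictly negative (equivalently the outer normal derivative is strictly positive). -/
theorem hopf_lemma_degenerate_parabolic
    (B m d0 T : ℝ)
    (hB : 0 < B) (hm : 0 < m) (hd0 : d0 ∈ Set.Ioo (0:ℝ) 1) (hT : 0 < T)
    (n0 : ℝ → ℝ) (hn0cont : Continuous n0)
    (hn0 : ∀ x ∈ Set.Icc (0:ℝ) d0, 0 ≤ n0 x ∧ n0 x ≤ m)
    (a b : ℝ → ℝ → ℝ)
    (hacont : ContinuousOn (fun p : ℝ × ℝ => a p.1 p.2) (Set.Icc 0 d0 ×ˢ Set.Icc 0 T))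
    (hbcont : ContinuousOn (fun p : ℝ × ℝ => b p.1 p.2) (Set.Icc 0 d0 ×ˢ Set.Icc 0 T))
    (ha : ∀ x ∈ Set.Icc (0:ℝ) d0, ∀ t ∈ Set.Icc (0:ℝ) T,
      1/(2*B) ≤ a x t ∧ a x t ≤ 2*B)
    (hb : ∀ x ∈ Set.Icc (0:ℝ) d0, ∀ t ∈ Set.Icc (0:ℝ) T, |b x t| ≤ 8*B*(m+1))
    -- `v` is of class C^{2,1} on `(0,d0) × (0,T]` and continuous on `[0,d0] × [0,T]`
    (v vx vxx vt : ℝ → ℝ → ℝ)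
    (hvx : ∀ x ∈ Set.Ioo (0:ℝ) d0, ∀ t ∈ Set.Ioc (0:ℝ) T,
      HasDerivAt (fun y => v y t) (vx x t) x)
    (hvxx : ∀ x ∈ Set.Ioo (0:ℝ) d0, ∀ t ∈ Set.Ioc (0:ℝ) T,
      HasDerivAt (fun y => vx y t) (vxx x t) x)
    (hvt : ∀ x ∈ Set.Ioo (0:ℝ) d0, ∀ t ∈ Set.Ioc (0:ℝ) T,
      HasDerivWithinAt (fun s => v x s) (vt x t) (Set.Iic T) t)
    (hvxcont : ContinuousOn (fun p : ℝ × ℝ => vx p.1 p.2) (Set.Ioo 0 d0 ×ˢ Set.Ioc 0 T))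
    (hvxxcont : ContinuousOn (fun p : ℝ × ℝ => vxx p.1 p.2) (Set.Ioo 0 d0 ×ˢ Set.Ioc 0 T))
    (hvtcont : ContinuousOn (fun p : ℝ × ℝ => vt p.1 p.2) (Set.Ioo 0 d0 ×ˢ Set.Ioc 0 T))
    (hvcont : ContinuousOn (fun p : ℝ × ℝ => v p.1 p.2) (Set.Icc 0 d0 ×ˢ Set.Icc 0 T))
    -- the domain `D_T`
    (ℓ t0 : ℝ) (hℓ : ℓ ∈ Set.Ioo (0:ℝ) d0) (ht0 : 3*ℓ^2/4 < t0) (ht0T : t0 ≤ T)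
    -- `Lv ≤ 0` on `D_T`
    (hLv : ∀ x t : ℝ, (x-ℓ)^2 + (t0-t) < ℓ^2 → 0 < x → x < ℓ/2 → 0 < t → t ≤ t0 →
      n0 x * vt x t - a x t * vxx x t - b x t * vx x t ≤ 0)
    -- `v < v(0,t0)` on `D_T`
    (hlt : ∀ x t : ℝ, (x-ℓ)^2 + (t0-t) < ℓ^2 → 0 < x → x < ℓ/2 → 0 < t → t ≤ t0 →
      v x t < v 0 t0)
    -- the one-sided spatial derivative of `v` at `(0,t0)` exists
    (dv : ℝ) (hdv : HasDerivWithinAt (fun y => v y t0) dv (Set.Ioi 0) 0) :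
    dv < 0 := by
  obtain ⟨hℓ0, hℓd⟩ := hℓ
  have ht0pos : 0 < t0 := lt_of_le_of_lt (by positivity) ht0
  -- The barrier is `x + K x² - (2/ℓ) (t0 - t)`, used on the strip `0 ≤ x ≤ δ`.
  obtain ⟨K, hK1, hKL⟩ : ∃ K : ℝ, 1 ≤ K ∧ 2 * m / ℓ + 24 * B * (m + 1) < K / B := by
    refine ⟨B * (2 * m / ℓ + 24 * B * (m + 1)) + 1, ?_, ?_⟩
    · have : 0 ≤ B * (2 * m / ℓ + 24 * B * (m + 1)) := by positivity
      linarith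
    · rw [lt_div_iff₀ hB]
      linarith
  have hK0 : 0 < K := by linarith
  obtain ⟨δ, hδ0, hδℓ, hδK⟩ : ∃ δ : ℝ, 0 < δ ∧ δ ≤ ℓ / 4 ∧ K * δ ≤ 1 := by
    refine ⟨min (ℓ / 4) (1 / K), by positivity, min_le_left _ _, ?_⟩
    calc K * min (ℓ / 4) (1 / K) ≤ K * (1 / K) := by gcongr; exact min_le_right _ _
      _ = 1 := by field_simp
  set h : ℝ → ℝ → ℝ := fun x t => x + K * x ^ 2 - 2 / ℓ * (t0 - t) with hh
  have htime : ∀ x t : ℝ, 0 ≤ x → x ≤ δ → 0 ≤ h x t → t0 - t ≤ ℓ * x := by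
    intro x t hx0 hxδ hpos
    have hKx : K * x ≤ 1 := le_trans (by gcongr) hδK
    have h1 : 2 / ℓ * (t0 - t) ≤ 2 * x := by
      simp only [hh] at hpos
      nlinarith [mul_nonneg hx0 (sub_nonneg.2 hKx)]
    rw [div_mul_eq_mul_div, div_le_iff₀ hℓ0] at h1
    linarith
  have htpos : ∀ x t : ℝ, x ≤ δ → t0 - t ≤ ℓ * x → 0 < t := by
    intro x t hxδ ht
    nlinarith
  have hmemD : ∀ x t : ℝ, 0 < x → x ≤ δ → t0 - t ≤ ℓ * x →
      (x - ℓ) ^ 2 + (t0 - t) < ℓ ^ 2 := by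
    intro x t hx0 hxδ ht
    nlinarith [mul_pos hx0 (show 0 < ℓ - x by linarith)]
  have hvlt : ∀ x t : ℝ, 0 < x → x ≤ δ → t ≤ t0 → t0 - t ≤ ℓ * x → v x t < v 0 t0 :=
    fun x t hx0 hxδ htt ht => hlt x t (hmemD x t hx0 hxδ ht) hx0 (by linarith)
      (htpos x t hxδ ht) htt
  obtain ⟨η, hη0, hη⟩ : ∃ η : ℝ, 0 < η ∧ ∀ t ∈ Icc (t0 - ℓ * δ) t0, v δ t ≤ v 0 t0 - η := by
    have hcont : ContinuousOn (fun t => v δ t) (Icc (t0 - ℓ * δ) t0) := by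
      refine hvcont.comp (f := fun t : ℝ => (δ, t)) (by fun_prop) fun t ht => ?_
      have := htpos δ t le_rfl (by linarith [ht.1])
      exact ⟨⟨hδ0.le, by linarith⟩, this.le, ht.2.trans ht0T⟩
    obtain ⟨s, hs, hsmax⟩ := isCompact_Icc.exists_isMaxOn
      (nonempty_Icc.2 (by nlinarith)) hcont
    refine ⟨v 0 t0 - v δ s, sub_pos.2 (hvlt δ s hδ0 le_rfl hs.2 (by linarith [hs.1])),
      fun t ht => ?_⟩
    have : v δ t ≤ v δ s := hsmax ht
    linarith
  obtain ⟨ε, hε0, hε⟩ : ∃ ε : ℝ, 0 < ε ∧ ε * (2 * δ) = η :=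
    ⟨η / (2 * δ), by positivity, by field_simp⟩
  set C : Set (ℝ × ℝ) := (Icc 0 δ ×ˢ Icc 0 t0) ∩ {p | 0 ≤ h p.1 p.2} with hC
  have hhcont : Continuous fun p : ℝ × ℝ => h p.1 p.2 := by
    simp only [hh]
    fun_prop
  have hCcompact : IsCompact C :=
    (isCompact_Icc.prod isCompact_Icc).inter_right (isClosed_le continuous_const hhcont)
  have hw_le : ∀ p ∈ C, v p.1 p.2 + ε * h p.1 p.2 ≤ v 0 t0 := by
    have hwcont : ContinuousOn (fun p : ℝ × ℝ => v p.1 p.2 + ε * h p.1 p.2) C := by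
      refine (hvcont.mono fun p hp => ?_).add (hhcont.const_smul ε).continuousOn
      exact ⟨⟨hp.1.1.1, by linarith [hp.1.1.2]⟩, hp.1.2.1, hp.1.2.2.trans ht0T⟩
    have hcorner : ((0 : ℝ), t0) ∈ C := by
      refine ⟨⟨⟨le_rfl, hδ0.le⟩, ht0pos.le, le_rfl⟩, ?_⟩
      simp [hh]
    obtain ⟨⟨x, t⟩, hp, hpmax⟩ := hCcompact.exists_isMaxOn ⟨_, hcorner⟩ hwcont
    suffices hsuff : v x t + ε * h x t ≤ v 0 t0 from fun q hq => le_trans (hpmax hq) hsuff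
    obtain ⟨⟨⟨hx0, hxδ⟩, -, htt⟩, hpos⟩ := hp
    simp only [mem_ofPred_eq] at hx0 hxδ htt hpos
    have ht := htime x t hx0 hxδ hpos
    rcases hx0.eq_or_lt with rfl | hx0
    · have : t = t0 := by linarith
      subst this
      simp [hh]
    rcases hxδ.eq_or_lt with rfl | hxδ'
    · have h1 := hη t ⟨by linarith, htt⟩
      have h2 : h x t ≤ 2 * x := by
        have : 0 ≤ 2 / ℓ * (t0 - t) := mul_nonneg (by positivity) (by linarith)
        simp only [hh]
        nlinarith
      have := mul_le_mul_of_nonneg_left h2 hε0.le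
      linarith
    rcases hpos.eq_or_lt with h0 | hpos
    · rw [← h0]
      linarith [hvlt x t hx0 hxδ htt ht]
    exfalso
    have ht1 := htpos x t hxδ ht
    have htT : t ≤ T := htt.trans ht0T
    have hxd : x < d0 := by linarith
    have hD := hLv x t (hmemD x t hx0 hxδ ht) hx0 (by linarith) ht1 htt
    have hxIoo : ∀ᶠ y in nhds x, y ∈ Ioo 0 δ := Ioo_mem_nhds hx0 hxδ'
    have hwx : ∀ y ∈ Ioo (0 : ℝ) δ, HasDerivAt (fun y => v y t + ε * h y t)
        (vx y t + ε * (1 + 2 * K * y)) y := by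
      intro y hy
      have hderiv : HasDerivAt (fun y => h y t) (1 + 2 * K * y) y := by
        have := (((hasDerivAt_id y).add ((hasDerivAt_pow 2 y).const_mul K)).sub_const
          (2 / ℓ * (t0 - t)))
        refine this.congr_deriv ?_
        simp
        ring
      exact (hvx y ⟨hy.1, by linarith [hy.2]⟩ t ⟨ht1, htT⟩).add (hderiv.const_mul ε)
    have hwxx : HasDerivAt (fun y => vx y t + ε * (1 + 2 * K * y)) (vxx x t + ε * (2 * K)) x := by
      refine (hvxx x ⟨hx0, hxd⟩ t ⟨ht1, htT⟩).add (HasDerivAt.const_mul ε ?_)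
      simpa using ((hasDerivAt_id x).const_mul (2 * K)).const_add 1
    have hmaxx : IsLocalMax (fun y => v y t + ε * h y t) x := by
      have hnear : ∀ᶠ y in nhds x, 0 < h y t :=
        (hhcont.comp (Continuous.prodMk_left t)).continuousAt.eventually_const_lt hpos
      filter_upwards [hnear, hxIoo] with y hy hyI
      exact hpmax (a := (y, t)) ⟨⟨⟨hyI.1.le, hyI.2.le⟩, ht1.le, htt⟩, hy.le⟩
    have hmaxt : IsLocalMaxOn (fun s => v x s + ε * h x s) (Iic t) t := by
      have hnear : ∀ᶠ s in nhds t, 0 < h x s :=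
        (hhcont.comp (Continuous.prodMk_right x)).continuousAt.eventually_const_lt hpos
      filter_upwards [nhdsWithin_le_nhds hnear, self_mem_nhdsWithin,
        nhdsWithin_le_nhds (lt_mem_nhds ht1)] with s hs hst hs0
      exact hpmax (a := (x, s)) ⟨⟨⟨hx0.le, hxδ⟩, le_of_lt hs0, le_trans hst htt⟩, hs.le⟩
    have hwt : HasDerivWithinAt (fun s => v x s + ε * h x s) (vt x t + ε * (2 / ℓ)) (Iic t) t := by
      refine ((hvt x ⟨hx0, hxd⟩ t ⟨ht1, htT⟩).mono (Iic_subset_Iic.2 htT)).add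
        (HasDerivWithinAt.const_mul ε (HasDerivAt.hasDerivWithinAt ?_))
      have := (((hasDerivAt_id t).const_sub t0).const_mul (2 / ℓ)).const_sub (x + K * x ^ 2)
      simpa using this
    have hx_eq : vx x t + ε * (1 + 2 * K * x) = 0 := hmaxx.hasDerivAt_eq_zero (hwx x ⟨hx0, hxδ'⟩)
    have hxx_le := hmaxx.second_deriv_nonpos (hxIoo.mono hwx) hwxx
    have ht_ge := hwt.nonneg_of_isLocalMaxOn_Iic hmaxt
    have hxI : x ∈ Icc (0 : ℝ) d0 := ⟨hx0.le, hxd.le⟩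
    have htI : t ∈ Icc (0 : ℝ) T := ⟨ht1.le, htT⟩
    obtain ⟨hn_nonneg, hn_le⟩ := hn0 x hxI
    obtain ⟨ha_lower, -⟩ := ha x hxI t htI
    have ha_pos : 0 < a x t := lt_of_lt_of_le (by positivity) ha_lower
    have hbarrier : n0 x * (2 / ℓ) - a x t * (2 * K) - b x t * (1 + 2 * K * x) < 0 := by
      have h1 : n0 x * (2 / ℓ) ≤ 2 * m / ℓ := by
        calc n0 x * (2 / ℓ) ≤ m * (2 / ℓ) := by gcongr
          _ = 2 * m / ℓ := by ring
      have h2 : K / B ≤ a x t * (2 * K) := by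
        calc K / B = 1 / (2 * B) * (2 * K) := by field_simp
          _ ≤ a x t * (2 * K) := by gcongr
      have hKx : K * x ≤ 1 := le_trans (by gcongr) hδK
      have hKx0 : 0 < K * x := by positivity
      have h3 : -(b x t * (1 + 2 * K * x)) ≤ 24 * B * (m + 1) := by
        calc -(b x t * (1 + 2 * K * x)) = -b x t * (1 + 2 * K * x) := by ring
          _ ≤ 8 * B * (m + 1) * 3 :=
            mul_le_mul ((neg_le_abs _).trans (hb x hxI t htI)) (by linarith) (by linarith)
              (by positivity)
          _ = 24 * B * (m + 1) := by ring
      linarith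
    have h1 := mul_nonneg hn_nonneg ht_ge
    have h2 := mul_nonpos_of_nonneg_of_nonpos ha_pos.le hxx_le
    have h3 : b x t * (vx x t + ε * (1 + 2 * K * x)) = 0 := by rw [hx_eq, mul_zero]
    have h4 := mul_neg_of_pos_of_neg hε0 hbarrier
    linarith
  suffices dv ≤ -ε by linarith
  have hlim := (hasDerivWithinAt_iff_tendsto_slope' self_notMem_Ioi).1 hdv
  refine le_of_tendsto hlim ?_
  filter_upwards [Ioo_mem_nhdsGT hδ0] with y hy
  have hhy : y ≤ h y t0 := by
    simp only [hh, sub_self, mul_zero, sub_zero]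
    nlinarith [sq_nonneg y]
  have hwy := hw_le (y, t0) ⟨⟨⟨hy.1.le, hy.2.le⟩, ht0pos.le, le_rfl⟩, hy.1.le.trans hhy⟩
  rw [slope_def_field, sub_zero, div_le_iff₀ hy.1]
  have := mul_le_mul_of_nonneg_left hhy hε0.le
  simp only at hwy
  linarith
end

section
/- Localized strong maximum principle for the degenerate parabolic operator: Assume in addition that n0(x) > 0 for all x ∈ (0,d0). Suppose v is of class C^{2,1} on (0,d0) × (0,T], is continuous on [0,d0] × [0,T], and satisfies (Lv)(x,t) ≤ 0 for all (x,t) ∈ (0,d0) × (0,T]. If v attains its maximum over [0,d0] × [0,T] at an interior point (x0,t0) ∈ (0,d0) × (0,T], then there exist a0 > 0 and a1 > 0 such that the rectangle R := [x0−a1, x0+a1] × [t0−a0, t0] is contained in (0,d0) × (0,T] and v(x,t) = v(x0,t0) for every (x,t) ∈ R. -/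
open Set Filter Topology

/-- Second-derivative test: the second derivative is nonpositive at a local maximum. -/
theorem second_deriv_nonpos_of_isLocalMax {f f' : ℝ → ℝ} {x f'' : ℝ}
    (hf : ∀ᶠ y in 𝓝 x, HasDerivAt f (f' y) y) (hf' : HasDerivAt f' f'' x)
    (hmax : IsLocalMax f x) : f'' ≤ 0 := by
  by_contra! hpos
  have hderiv : deriv f =ᶠ[𝓝 x] f' := hf.mono fun y hy => hy.deriv
  have hderiv2 : deriv (deriv f) x = f'' := hderiv.deriv_eq.trans hf'.deriv
  have hmin : IsLocalMin f x :=
    isLocalMin_of_deriv_deriv_pos (hderiv2 ▸ hpos) hmax.deriv_eq_zero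
      hf.self_of_nhds.continuousAt
  have hconst : f =ᶠ[𝓝 x] fun _ => f x := by
    filter_upwards [hmax, hmin] with y h1 h2 using le_antisymm h1 h2
  have hzero : deriv f =ᶠ[𝓝 x] fun _ => (0 : ℝ) := by
    simpa using hconst.deriv
  have : deriv (deriv f) x = 0 := by simpa using hzero.deriv_eq
  linarith

/-- The left derivative is nonnegative at a maximum from the left. -/
theorem left_deriv_nonneg_of_eventually_le {g : ℝ → ℝ} {t g' : ℝ}
    (hg : HasDerivWithinAt g g' (Iic t) t) (hmax : ∀ᶠ s in 𝓝[<] t, g s ≤ g t) : 0 ≤ g' := by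
  have h := hasDerivWithinAt_iff_tendsto_slope.1 hg
  rw [Iic_sdiff_right] at h
  refine ge_of_tendsto h ?_
  filter_upwards [hmax, self_mem_nhdsWithin] with s hs hst
  rw [slope_def_field]
  exact div_nonneg_of_nonpos (by linarith) (by linarith [mem_Iio.1 hst])

/-- For a large decay rate, the barrier `exp (-K t) (r² - (x - σ t)²)²` is a strict subsolution.
Here `y = x - σ t`. -/
theorem exists_barrier_decay_rate {c m α A β r : ℝ} (σ : ℝ) (hc : 0 < c) (hα : 0 < α)
    (hr : 0 < r) :
    ∃ K : ℝ, ∀ n a b y : ℝ, c ≤ n → n ≤ m → α ≤ a → a ≤ A → |b| ≤ β → |y| ≤ r →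
      n * (-K * (r ^ 2 - y ^ 2) ^ 2 + 4 * σ * y * (r ^ 2 - y ^ 2))
        - a * (8 * y ^ 2 - 4 * (r ^ 2 - y ^ 2)) - b * (-(4 * y * (r ^ 2 - y ^ 2))) < 0 := by
  set C := 4 * (m * |σ| * r) + 12 * A + 4 * (β * r) with hC
  refine ⟨C ^ 2 / (16 * α * r ^ 2) / c, fun n a b y hcn hnm hαa haA hb hy => ?_⟩
  set K := C ^ 2 / (16 * α * r ^ 2) / c with hK
  have hq : 0 ≤ r ^ 2 - y ^ 2 := by
    have := sq_le_sq.2 (hy.trans (le_abs_self r)); linarith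
  obtain ⟨q, hqdef⟩ : ∃ q, r ^ 2 - y ^ 2 = q := ⟨_, rfl⟩
  have hy2 : y ^ 2 = r ^ 2 - q := by linarith
  rw [hqdef] at hq ⊢
  have hK0 : 0 ≤ K := by positivity
  have h1 : c * K * q ^ 2 ≤ n * K * q ^ 2 := by gcongr
  have h2 : n * σ * y ≤ m * |σ| * r := by
    have hm : 0 ≤ m := by linarith
    calc n * σ * y ≤ |n * σ * y| := le_abs_self _
      _ = n * |σ| * |y| := by rw [abs_mul, abs_mul, abs_of_pos (hc.trans_le hcn)]
      _ ≤ m * |σ| * r := by gcongr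
  have h3 : b * y ≤ β * r := by
    calc b * y ≤ |b * y| := le_abs_self _
      _ = |b| * |y| := abs_mul _ _
      _ ≤ β * r := mul_le_mul hb hy (abs_nonneg _) ((abs_nonneg _).trans hb)
  have h4 : (4 * (n * σ * y) + 12 * a + 4 * (b * y)) * q ≤ C * q := by
    gcongr; rw [hC]; linarith
  have h5 : α * r ^ 2 ≤ a * r ^ 2 := by gcongr
  have h6 : C * q ≤ 4 * (α * r ^ 2) + c * K * q ^ 2 := by
    have hp : 0 < α * r ^ 2 := by positivity
    have hcK : c * K = C ^ 2 / (16 * (α * r ^ 2)) := by rw [hK]; field_simp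
    have : 4 * (α * r ^ 2) + c * K * q ^ 2 - C * q
        = (8 * (α * r ^ 2) - C * q) ^ 2 / (16 * (α * r ^ 2)) := by
      rw [hcK]; field_simp; ring
    have : 0 ≤ (8 * (α * r ^ 2) - C * q) ^ 2 / (16 * (α * r ^ 2)) := by positivity
    linarith
  have hp : 0 < α * r ^ 2 := by positivity
  rw [hy2]
  linarith

/-- If a subsolution of `n ∂ₜ - a ∂ₓₓ - b ∂ₓ` bounded by `M` stays strictly below `M` on a segment
around `x₁` at time `t₁`, then it is strictly below `M` at `x₀` at any later time `t₀`. -/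
theorem subsolution_lt_of_lt_earlier {n : ℝ → ℝ} {a b v vx vxx vt : ℝ → ℝ → ℝ}
    {c m α A β r δ M p q x₀ x₁ t₀ t₁ : ℝ}
    (hc : 0 < c) (hα : 0 < α) (hr : 0 < r) (hδ : 0 < δ) (ht : t₁ < t₀)
    (hx₁ : p ≤ x₁ - r ∧ x₁ + r ≤ q) (hx₀ : p ≤ x₀ - r ∧ x₀ + r ≤ q)
    (hn : ∀ x ∈ Icc p q, c ≤ n x ∧ n x ≤ m)
    (ha : ∀ x ∈ Icc p q, ∀ t ∈ Icc t₁ t₀, α ≤ a x t ∧ a x t ≤ A)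
    (hb : ∀ x ∈ Icc p q, ∀ t ∈ Icc t₁ t₀, |b x t| ≤ β)
    (hvx : ∀ x ∈ Ioo p q, ∀ t ∈ Ioc t₁ t₀, HasDerivAt (fun y => v y t) (vx x t) x)
    (hvxx : ∀ x ∈ Ioo p q, ∀ t ∈ Ioc t₁ t₀, HasDerivAt (fun y => vx y t) (vxx x t) x)
    (hvt : ∀ x ∈ Ioo p q, ∀ t ∈ Ioc t₁ t₀, HasDerivWithinAt (fun s => v x s) (vt x t) (Iic t) t)
    (hv : ContinuousOn (fun z : ℝ × ℝ => v z.1 z.2) (Icc p q ×ˢ Icc t₁ t₀))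
    (hL : ∀ x ∈ Ioo p q, ∀ t ∈ Ioc t₁ t₀,
      n x * vt x t - a x t * vxx x t - b x t * vx x t ≤ 0)
    (hM : ∀ x ∈ Icc p q, ∀ t ∈ Icc t₁ t₀, v x t ≤ M)
    (hinit : ∀ x ∈ Icc (x₁ - r) (x₁ + r), v x t₁ ≤ M - δ) :
    v x₀ t₀ < M := by
  have htt : 0 < t₀ - t₁ := sub_pos.2 ht
  set σ := (x₀ - x₁) / (t₀ - t₁) with hσ
  have hσ₀ : σ * (t₀ - t₁) = x₀ - x₁ := by rw [hσ]; field_simp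
  obtain ⟨K, hK⟩ := exists_barrier_decay_rate (m := m) (A := A) (β := β) σ hc hα hr
  set y : ℝ → ℝ → ℝ := fun x t => x - x₁ - σ * (t - t₁) with hy
  set E : ℝ → ℝ := fun t => δ / r ^ 4 * Real.exp (-K * (t - t₁)) with hE
  have hEpos : ∀ t, 0 < E t := fun t => by positivity
  set φ : ℝ → ℝ → ℝ := fun x t => E t * (r ^ 2 - y x t ^ 2) ^ 2 with hφ
  have hyx : ∀ x t, HasDerivAt (fun z => y z t) 1 x := fun x t =>
    ((hasDerivAt_id x).sub_const x₁).sub_const _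
  have hyt : ∀ x t, HasDerivAt (fun s => y x s) (-σ) t := fun x t => by
    simpa using (((hasDerivAt_id t).sub_const t₁).const_mul σ).const_sub (x - x₁)
  have hφx : ∀ x t, HasDerivAt (fun z => φ z t)
      (E t * (-(4 * y x t * (r ^ 2 - y x t ^ 2)))) x := fun x t => by
    refine (((((hyx x t).fun_pow 2).const_sub (r ^ 2)).fun_pow 2).const_mul (E t)).congr_deriv ?_
    push_cast; ring
  have hφxx : ∀ x t, HasDerivAt (fun z => E t * (-(4 * y z t * (r ^ 2 - y z t ^ 2))))
      (E t * (8 * y x t ^ 2 - 4 * (r ^ 2 - y x t ^ 2))) x := fun x t => by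
    refine (((((hyx x t).const_mul 4).fun_mul
      (((hyx x t).fun_pow 2).const_sub (r ^ 2))).fun_neg).const_mul (E t)).congr_deriv ?_
    push_cast; ring
  have hφt : ∀ x t, HasDerivAt (fun s => φ x s)
      (E t * (-K * (r ^ 2 - y x t ^ 2) ^ 2 + 4 * σ * y x t * (r ^ 2 - y x t ^ 2))) t :=
    fun x t => by
    have hEt : HasDerivAt E (E t * -K) t := by
      refine (((((hasDerivAt_id t).sub_const t₁).const_mul (-K)).exp).const_mul
        (δ / r ^ 4)).congr_deriv ?_
      simp only [hE, id]; ring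
    refine (hEt.fun_mul ((((hyt x t).fun_pow 2).const_sub (r ^ 2)).fun_pow 2)).congr_deriv ?_
    push_cast; ring
  have hycont : Continuous (fun z : ℝ × ℝ => y z.1 z.2) := by
    simp only [hy]; fun_prop
  have hφcont : Continuous (fun z : ℝ × ℝ => φ z.1 z.2) := by
    simp only [hφ, hE, hy]; fun_prop
  set D : Set (ℝ × ℝ) := Icc p q ×ˢ Icc t₁ t₀ ∩ {z | |y z.1 z.2| ≤ r} with hD
  have hDcompact : IsCompact D :=
    (isCompact_Icc.prod isCompact_Icc).inter_right
      (isClosed_le hycont.abs continuous_const)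
  have hy₀ : y x₀ t₀ = 0 := by simp only [hy]; linarith
  have hmem₀ : (x₀, t₀) ∈ D := by
    refine ⟨⟨⟨by linarith, by linarith⟩, ⟨ht.le, le_rfl⟩⟩, ?_⟩
    simp [hy₀, hr.le]
  obtain ⟨⟨x, t⟩, ⟨⟨hxpq, htI⟩, hyr⟩, hzmax⟩ := hDcompact.exists_isMaxOn ⟨_, hmem₀⟩
    ((hv.mono inter_subset_left).add hφcont.continuousOn)
  simp only [mem_ofPred_eq] at hxpq htI hyr
  by_contra! hcon
  have hgt : M < v x t + φ x t := by
    have h := hzmax hmem₀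
    have : 0 < φ x₀ t₀ := by
      simp only [hφ, hy₀]; exact mul_pos (hEpos t₀) (by rw [zero_pow two_ne_zero, sub_zero]; positivity)
    exact hcon.trans_lt ((lt_add_of_pos_right _ this).trans_le h)
  have ht₁ : t₁ < t := by
    rcases htI.1.lt_or_eq with h | h
    · exact h
    exfalso
    subst h
    have h1 : y x t₁ = x - x₁ := by simp [hy]
    rw [h1] at hyr
    have h2 := hinit x (by constructor <;> linarith [abs_le.1 hyr])
    have h3 : φ x t₁ ≤ δ := by
      have hq : 0 ≤ r ^ 2 - (x - x₁) ^ 2 := by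
        have := sq_le_sq.2 (hyr.trans (le_abs_self r)); linarith
      calc φ x t₁ = δ / r ^ 4 * (r ^ 2 - (x - x₁) ^ 2) ^ 2 := by simp [hφ, hE, h1]
        _ ≤ δ / r ^ 4 * (r ^ 2) ^ 2 := by gcongr; nlinarith [sq_nonneg (x - x₁)]
        _ = δ := by field_simp
    linarith
  have hyr' : |y x t| < r := by
    refine hyr.lt_of_ne fun h => ?_
    have : φ x t = 0 := by
      have : y x t ^ 2 = r ^ 2 := by rw [← sq_abs, h]
      simp [hφ, this]
    linarith [hM x hxpq t htI]
  have hin : ∀ x' t', t' ∈ Icc t₁ t₀ → |y x' t'| < r → x' ∈ Ioo p q := by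
    intro x' t' ht' h
    obtain ⟨h1, h2⟩ := abs_lt.1 h
    have hs : 0 ≤ (t' - t₁) / (t₀ - t₁) := div_nonneg (by linarith [ht'.1]) htt.le
    have hs' : (t' - t₁) / (t₀ - t₁) ≤ 1 := (div_le_one htt).2 (by linarith [ht'.2])
    have h3 : σ * (t' - t₁) = (x₀ - x₁) * ((t' - t₁) / (t₀ - t₁)) := by rw [hσ]; ring
    simp only [hy, h3] at h1 h2
    constructor
    · nlinarith [mul_nonneg hs (by linarith : 0 ≤ x₀ - r - p),
        mul_nonneg (sub_nonneg.2 hs') (by linarith : 0 ≤ x₁ - r - p)]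
    · nlinarith [mul_nonneg hs (by linarith : 0 ≤ q - (x₀ + r)),
        mul_nonneg (sub_nonneg.2 hs') (by linarith : 0 ≤ q - (x₁ + r))]
  have hxI : x ∈ Ioo p q := hin x t htI hyr'
  have htI' : t ∈ Ioc t₁ t₀ := ⟨ht₁, htI.2⟩
  have hle : ∀ x' t', t' ∈ Icc t₁ t₀ → |y x' t'| < r → v x' t' + φ x' t' ≤ v x t + φ x t :=
    fun x' t' ht' h => hzmax (a := (x', t')) ⟨⟨Ioo_subset_Icc_self (hin x' t' ht' h), ht'⟩, h.le⟩
  have hlocmax : IsLocalMax (fun z => v z t + φ z t) x := by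
    have : ∀ᶠ z in 𝓝 x, |y z t| < r :=
      (hyx x t).continuousAt.abs.eventually_lt continuousAt_const hyr'
    exact this.mono fun z hz => hle z t htI hz
  have hux : vx x t + E t * (-(4 * y x t * (r ^ 2 - y x t ^ 2))) = 0 :=
    hlocmax.hasDerivAt_eq_zero ((hvx x hxI t htI').add (hφx x t))
  have huxx : vxx x t + E t * (8 * y x t ^ 2 - 4 * (r ^ 2 - y x t ^ 2)) ≤ 0 := by
    refine second_deriv_nonpos_of_isLocalMax ?_
      ((hvxx x hxI t htI').add (hφxx x t)) hlocmax
    filter_upwards [Ioo_mem_nhds hxI.1 hxI.2] with z hz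
    exact (hvx z hz t htI').add (hφx z t)
  have hut : 0 ≤ vt x t +
      E t * (-K * (r ^ 2 - y x t ^ 2) ^ 2 + 4 * σ * y x t * (r ^ 2 - y x t ^ 2)) := by
    refine left_deriv_nonneg_of_eventually_le
      ((hvt x hxI t htI').add (hφt x t).hasDerivWithinAt) ?_
    have : ∀ᶠ s in 𝓝 t, |y x s| < r :=
      (hyt x t).continuousAt.abs.eventually_lt continuousAt_const hyr'
    filter_upwards [this.filter_mono nhdsWithin_le_nhds,
      (Ioi_mem_nhds ht₁ |> mem_nhdsWithin_of_mem_nhds), self_mem_nhdsWithin] with s hs h1 h2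
    exact hle x s ⟨(mem_Ioi.1 h1).le, (mem_Iio.1 h2).le.trans htI.2⟩ hs
  have hLφ := mul_neg_of_pos_of_neg (hEpos t) (hK (n x) (a x t) (b x t) (y x t) (hn x hxpq).1
    (hn x hxpq).2 (ha x hxpq t htI).1 (ha x hxpq t htI).2 (hb x hxpq t htI) hyr)
  have h1 := mul_nonneg (hc.le.trans (hn x hxpq).1) hut
  have h2 := mul_nonpos_of_nonneg_of_nonpos (hα.le.trans (ha x hxpq t htI).1) huxx
  have h3 : b x t * (vx x t + E t * (-(4 * y x t * (r ^ 2 - y x t ^ 2)))) = 0 := by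
    rw [hux, mul_zero]
  have h4 := hL x hxI t htI'
  linarith

/-- Localized strong maximum principle for the degenerate parabolic operator
    `(Lv)(x,t) = n0(x) vₜ - a(x,t) vₓₓ - b(x,t) vₓ` (with `n0 > 0` on `(0,d0)`):
    if `Lv ≤ 0` on `(0,d0) × (0,T]` and `v` attains its maximum over `[0,d0] × [0,T]`
    at an interior point `(x0,t0) ∈ (0,d0) × (0,T]`, then `v ≡ v(x0,t0)` on some
    rectangle `[x0-a1, x0+a1] × [t0-a0, t0] ⊆ (0,d0) × (0,T]`. -/
theorem localized_strong_maximum_principle_degenerate_parabolic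
    (B m d0 T : ℝ)
    (hB : 0 < B) (hm : 0 < m) (hd0 : d0 ∈ Set.Ioo (0:ℝ) 1) (hT : 0 < T)
    (n0 : ℝ → ℝ) (hn0cont : Continuous n0)
    (hn0 : ∀ x ∈ Set.Icc (0:ℝ) d0, 0 ≤ n0 x ∧ n0 x ≤ m)
    (a b : ℝ → ℝ → ℝ)
    (hacont : ContinuousOn (fun p : ℝ × ℝ => a p.1 p.2) (Set.Icc 0 d0 ×ˢ Set.Icc 0 T))
    (hbcont : ContinuousOn (fun p : ℝ × ℝ => b p.1 p.2) (Set.Icc 0 d0 ×ˢ Set.Icc 0 T))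
    (ha : ∀ x ∈ Set.Icc (0:ℝ) d0, ∀ t ∈ Set.Icc (0:ℝ) T,
      1/(2*B) ≤ a x t ∧ a x t ≤ 2*B)
    (hb : ∀ x ∈ Set.Icc (0:ℝ) d0, ∀ t ∈ Set.Icc (0:ℝ) T, |b x t| ≤ 8*B*(m+1))
    (v vx vxx vt : ℝ → ℝ → ℝ)
    (hvx : ∀ x ∈ Set.Ioo (0:ℝ) d0, ∀ t ∈ Set.Ioc (0:ℝ) T,
      HasDerivAt (fun y => v y t) (vx x t) x)
    (hvxx : ∀ x ∈ Set.Ioo (0:ℝ) d0, ∀ t ∈ Set.Ioc (0:ℝ) T,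
      HasDerivAt (fun y => vx y t) (vxx x t) x)
    (hvt : ∀ x ∈ Set.Ioo (0:ℝ) d0, ∀ t ∈ Set.Ioc (0:ℝ) T,
      HasDerivWithinAt (fun s => v x s) (vt x t) (Set.Iic T) t)
    (hvxcont : ContinuousOn (fun p : ℝ × ℝ => vx p.1 p.2) (Set.Ioo 0 d0 ×ˢ Set.Ioc 0 T))
    (hvxxcont : ContinuousOn (fun p : ℝ × ℝ => vxx p.1 p.2) (Set.Ioo 0 d0 ×ˢ Set.Ioc 0 T))
    (hvtcont : ContinuousOn (fun p : ℝ × ℝ => vt p.1 p.2) (Set.Ioo 0 d0 ×ˢ Set.Ioc 0 T))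
    (hvcont : ContinuousOn (fun p : ℝ × ℝ => v p.1 p.2) (Set.Icc 0 d0 ×ˢ Set.Icc 0 T))
    (hLv : ∀ x ∈ Set.Ioo (0:ℝ) d0, ∀ t ∈ Set.Ioc (0:ℝ) T,
      n0 x * vt x t - a x t * vxx x t - b x t * vx x t ≤ 0)
    (hn0pos : ∀ x ∈ Set.Ioo (0:ℝ) d0, 0 < n0 x)
    (x0 t0 : ℝ) (hx0 : x0 ∈ Set.Ioo (0:ℝ) d0) (ht0 : t0 ∈ Set.Ioc (0:ℝ) T)
    (hmax : ∀ x ∈ Set.Icc (0:ℝ) d0, ∀ t ∈ Set.Icc (0:ℝ) T, v x t ≤ v x0 t0) :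
    ∃ a0 > (0:ℝ), ∃ a1 > (0:ℝ),
      Set.Icc (x0-a1) (x0+a1) ×ˢ Set.Icc (t0-a0) t0 ⊆ Set.Ioo (0:ℝ) d0 ×ˢ Set.Ioc (0:ℝ) T ∧
      ∀ x ∈ Set.Icc (x0-a1) (x0+a1), ∀ t ∈ Set.Icc (t0-a0) t0, v x t = v x0 t0 := by
  have earlier : ∀ x ∈ Ioo (0:ℝ) d0, ∀ t ∈ Ioo (0:ℝ) t0, v x t = v x0 t0 := by
    intro x1 hx1 t1 ht1
    have ht1' : t1 ∈ Icc (0:ℝ) T := ⟨ht1.1.le, ht1.2.le.trans ht0.2⟩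
    refine (hmax x1 (Ioo_subset_Icc_self hx1) t1 ht1').antisymm ?_
    by_contra! hlt
    obtain ⟨μ, hμ1, hμ2⟩ := exists_between hlt
    have hvc : ContinuousAt (fun y => v y t1) x1 :=
      (hvx x1 hx1 t1 ⟨ht1.1, ht1'.2⟩).continuousAt
    obtain ⟨ε, hε, hball⟩ := Metric.eventually_nhds_iff.1
      (hvc.eventually_lt continuousAt_const hμ1)
    set s := min (min x0 x1) (min (d0 - x0) (d0 - x1)) with hs
    have hspos : 0 < s := lt_min (lt_min hx0.1 hx1.1)
      (lt_min (sub_pos.2 hx0.2) (sub_pos.2 hx1.2))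
    have hs0 : s ≤ x0 ∧ s ≤ x1 ∧ s ≤ d0 - x0 ∧ s ≤ d0 - x1 := by simp [hs]
    obtain ⟨hs1, hs2, hs3, hs4⟩ := hs0
    set r := min (s / 2) (ε / 2) with hr
    have hrpos : 0 < r := lt_min (by linarith) (by linarith)
    have hrs : r ≤ s / 2 := min_le_left _ _
    have hrε : r ≤ ε / 2 := min_le_right _ _
    have hsub : Icc (s / 2) (d0 - s / 2) ⊆ Ioo 0 d0 := fun x hx =>
      ⟨by linarith [hx.1], by linarith [hx.2]⟩
    have hsub' : Ioo (s / 2) (d0 - s / 2) ⊆ Ioo 0 d0 := Ioo_subset_Icc_self.trans hsub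
    have hsubC : Icc (s / 2) (d0 - s / 2) ⊆ Icc 0 d0 := hsub.trans Ioo_subset_Icc_self
    have htsub : Icc t1 t0 ⊆ Icc 0 T := Icc_subset_Icc ht1.1.le ht0.2
    have htsub' : Ioc t1 t0 ⊆ Ioc 0 T := Ioc_subset_Ioc ht1.1.le ht0.2
    obtain ⟨xm, hxm, hmin⟩ := isCompact_Icc.exists_isMinOn
      (⟨x0, by linarith, by linarith⟩ : (Icc (s / 2) (d0 - s / 2)).Nonempty)
      hn0cont.continuousOn
    refine lt_irrefl (v x0 t0) (subsolution_lt_of_lt_earlier (n := n0) (a := a) (b := b)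
      (v := v) (vx := vx) (vxx := vxx) (vt := vt) (α := 1 / (2 * B)) (δ := v x0 t0 - μ)
      (p := s / 2) (q := d0 - s / 2) (x₁ := x1) (t₁ := t1)
      (hn0pos xm (hsub hxm)) (by positivity) hrpos (by linarith) ht1.2
      ⟨by linarith, by linarith⟩ ⟨by linarith, by linarith⟩
      (fun x hx => ⟨hmin hx, (hn0 x (hsubC hx)).2⟩)
      (fun x hx t ht => ha x (hsubC hx) t (htsub ht))
      (fun x hx t ht => hb x (hsubC hx) t (htsub ht))
      (fun x hx t ht => hvx x (hsub' hx) t (htsub' ht))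
      (fun x hx t ht => hvxx x (hsub' hx) t (htsub' ht))
      (fun x hx t ht => (hvt x (hsub' hx) t (htsub' ht)).mono
        (Iic_subset_Iic.2 (htsub' ht).2))
      (hvcont.mono (prod_mono hsubC htsub))
      (fun x hx t ht => hLv x (hsub' hx) t (htsub' ht))
      (fun x hx t ht => hmax x (hsubC hx) t (htsub ht))
      (fun x hx => ?_))
    have : dist x x1 < ε := by
      rw [Real.dist_eq, abs_lt]; constructor <;> linarith [hx.1, hx.2]
    linarith [hball this]
  have upto : ∀ x ∈ Ioo (0:ℝ) d0, ∀ t ∈ Ioc (0:ℝ) t0, v x t = v x0 t0 := by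
    intro x hx t ht
    have htT : t ∈ Ioc (0:ℝ) T := ⟨ht.1, ht.2.trans ht0.2⟩
    have hlim : Tendsto (fun s => v x s) (𝓝[<] t) (𝓝 (v x t)) :=
      ((hvt x hx t htT).continuousWithinAt.mono
        (fun s hs => (mem_Iio.1 hs).le.trans htT.2)).tendsto
    refine tendsto_nhds_unique hlim (tendsto_const_nhds.congr' ?_)
    filter_upwards [Ioo_mem_nhdsLT ht.1] with s hs
    exact (earlier x hx s ⟨hs.1, hs.2.trans_le ht.2⟩).symm
  obtain ⟨a1, ha1, ha1'⟩ := exists_between (lt_min hx0.1 (sub_pos.2 hx0.2))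
  obtain ⟨h1, h2⟩ := lt_min_iff.1 ha1'
  have hxmem : ∀ x ∈ Icc (x0 - a1) (x0 + a1), x ∈ Ioo 0 d0 := fun x hx =>
    ⟨by linarith [hx.1], by linarith [hx.2]⟩
  have htmem : ∀ t ∈ Icc (t0 - t0 / 2) t0, t ∈ Ioc 0 t0 := fun t ht =>
    ⟨by linarith [ht.1, ht0.1], ht.2⟩
  exact ⟨t0 / 2, half_pos ht0.1, a1, ha1,
    prod_mono hxmem (fun t ht => ⟨(htmem t ht).1, ht.2.trans ht0.2⟩),
    fun x hx t ht => upto x (hxmem x hx) t (htmem t ht)⟩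
end

section
/- Strong maximum principle for the degenerate parabolic operator: Assume in addition that n0(x) > 0 for all x ∈ (0,d0). Suppose v is of class C^{2,1} on (0,d0) × (0,T], is continuous on [0,d0] × [0,T], and satisfies (Lv)(x,t) ≤ 0 for all (x,t) ∈ (0,d0) × (0,T]. If v attains its maximum over [0,d0] × [0,T] at an interior point (x0,t0) ∈ (0,d0) × (0,T], then v(x,t) = v(x0,t0) for every (x,t) ∈ (0,d0) × (0,t0]. -/
open Set

open Filter Topology

/-- Second-derivative test, necessary direction. -/
theorem IsLocalMin.second_deriv_nonneg {f f' : ℝ → ℝ} {x c : ℝ} (hmin : IsLocalMin f x)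
    (hf : ∀ᶠ y in 𝓝 x, HasDerivAt f (f' y) y) (hf' : HasDerivAt f' c x) : 0 ≤ c := by
  by_contra! hc
  have hd : deriv f =ᶠ[𝓝 x] f' := hf.mono fun y hy => hy.deriv
  have hdd : deriv (deriv f) x = c := by rw [hd.deriv_eq, hf'.deriv]
  have hmax : IsLocalMax f x := isLocalMax_of_deriv_deriv_neg (by rwa [hdd])
    hmin.deriv_eq_zero hf.self_of_nhds.continuousAt
  have hconst : f =ᶠ[𝓝 x] fun _ => f x := by
    filter_upwards [hmin, hmax] with y h1 h2 using le_antisymm h2 h1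
  have h0 : deriv (deriv f) x = 0 := by
    rw [hconst.deriv.deriv_eq]
    simp
  linarith

/-- The left derivative at a left-sided local minimum is nonpositive. -/
theorem HasDerivWithinAt.nonpos_of_eventually_le_left {g : ℝ → ℝ} {t c : ℝ}
    (hg : HasDerivWithinAt g c (Iio t) t) (hle : ∀ᶠ s in 𝓝[<] t, g t ≤ g s) : c ≤ 0 := by
  have h := (hasDerivWithinAt_iff_tendsto_slope' (by simp)).1 hg
  refine le_of_tendsto h ?_
  filter_upwards [hle, self_mem_nhdsWithin] with s hs hst
  rw [slope_def_field]
  exact div_nonpos_of_nonneg_of_nonpos (by linarith) (by linarith [mem_Iio.1 hst])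

/-- Barrier supported in an oblique cylinder of radius `r` with axis through `(x₁, t₁)` and
slope `k`, decaying exponentially in time. -/
noncomputable def obliqueBarrier (ε α r x₁ t₁ k x t : ℝ) : ℝ :=
  ε * Real.exp (-α * (t - t₁)) * (r ^ 2 - (x - (x₁ + k * (t - t₁))) ^ 2) ^ 2

section obliqueBarrier

variable (ε α r x₁ t₁ k x t : ℝ)

theorem continuous_obliqueBarrier :
    Continuous fun p : ℝ × ℝ => obliqueBarrier ε α r x₁ t₁ k p.1 p.2 := by
  unfold obliqueBarrier
  fun_prop

theorem hasDerivAt_obliqueBarrier_space :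
    HasDerivAt (fun y => obliqueBarrier ε α r x₁ t₁ k y t)
      (ε * Real.exp (-α * (t - t₁)) * (-4 * (x - (x₁ + k * (t - t₁))) *
        (r ^ 2 - (x - (x₁ + k * (t - t₁))) ^ 2))) x := by
  have h := ((((((hasDerivAt_id x).sub_const (x₁ + k * (t - t₁))).pow 2).const_sub
    (r ^ 2)).pow 2).const_mul (ε * Real.exp (-α * (t - t₁))))
  refine h.congr_deriv ?_
  simp only [Pi.pow_apply, id]
  push_cast
  ring

theorem hasDerivAt_obliqueBarrier_space_space :
    HasDerivAt (fun y => ε * Real.exp (-α * (t - t₁)) * (-4 * (y - (x₁ + k * (t - t₁))) *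
        (r ^ 2 - (y - (x₁ + k * (t - t₁))) ^ 2)))
      (ε * Real.exp (-α * (t - t₁)) * (8 * (x - (x₁ + k * (t - t₁))) ^ 2 -
        4 * (r ^ 2 - (x - (x₁ + k * (t - t₁))) ^ 2))) x := by
  have h0 := (hasDerivAt_id x).sub_const (x₁ + k * (t - t₁))
  have h := ((h0.const_mul (-4)).mul ((h0.pow 2).const_sub (r ^ 2))).const_mul
    (ε * Real.exp (-α * (t - t₁)))
  refine h.congr_deriv ?_
  simp only [Pi.pow_apply, id]
  push_cast
  ring

theorem hasDerivAt_obliqueBarrier_time :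
    HasDerivAt (fun s => obliqueBarrier ε α r x₁ t₁ k x s)
      (ε * Real.exp (-α * (t - t₁)) * (-α * (r ^ 2 - (x - (x₁ + k * (t - t₁))) ^ 2) ^ 2 +
        4 * k * (x - (x₁ + k * (t - t₁))) * (r ^ 2 - (x - (x₁ + k * (t - t₁))) ^ 2))) t := by
  have h0 := (hasDerivAt_id t).sub_const t₁
  have h1 := ((h0.const_mul (-α)).exp).const_mul ε
  have h2 := ((((h0.const_mul k).const_add x₁).const_sub x).pow 2).const_sub (r ^ 2)
  refine (h1.mul (h2.pow 2)).congr_deriv ?_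
  simp
  ring

variable {ε r}

theorem obliqueBarrier_axis_pos (hε : 0 < ε) (hr : 0 < r) :
    0 < obliqueBarrier ε α r x₁ t₁ k (x₁ + k * (t - t₁)) t := by
  unfold obliqueBarrier
  rw [sub_self, zero_pow two_ne_zero, sub_zero]
  positivity

variable {x x₁ t t₁ k}

theorem obliqueBarrier_eq_zero (h : |x - (x₁ + k * (t - t₁))| = r) :
    obliqueBarrier ε α r x₁ t₁ k x t = 0 := by
  unfold obliqueBarrier
  rw [← sq_abs (x - _), h]
  ring

theorem obliqueBarrier_initial_le (hε : 0 ≤ ε) (hr : r ≤ 1) (hx : |x - x₁| ≤ r) :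
    obliqueBarrier ε α r x₁ t₁ k x t₁ ≤ ε := by
  have hr0 : 0 ≤ r := (abs_nonneg _).trans hx
  have h1 : (x - x₁) ^ 2 ≤ r ^ 2 := sq_le_sq' (abs_le.1 hx).1 (abs_le.1 hx).2
  have h2 : r ^ 2 ≤ 1 := pow_le_one₀ hr0 hr
  have h3 : (r ^ 2 - (x - x₁) ^ 2) ^ 2 ≤ 1 :=
    pow_le_one₀ (by linarith) (by linarith [sq_nonneg (x - x₁)])
  unfold obliqueBarrier
  simp only [sub_self, mul_zero, Real.exp_zero, add_zero, mul_one]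
  exact mul_le_of_le_one_right hε h3

end obliqueBarrier

/-- The pointwise inequality that makes the oblique barrier a strict subsolution. -/
theorem obliqueBarrier_operator_neg {α ν n a₀ a b C k r s : ℝ} (hα : 0 ≤ α) (ha₀ : 0 < a₀)
    (hr : 0 < r) (hn : ν ≤ n) (ha : a₀ ≤ a) (hs : s ^ 2 ≤ r ^ 2)
    (hC : 4 * n * k * s + 4 * a + 4 * b * s ≤ C)
    (hαν : 16 * (α * ν) * (a₀ * r ^ 2) = (C + 8 * a₀) ^ 2) :
    n * (-α * (r ^ 2 - s ^ 2) ^ 2 + 4 * k * s * (r ^ 2 - s ^ 2)) -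
      a * (8 * s ^ 2 - 4 * (r ^ 2 - s ^ 2)) - b * (-4 * s * (r ^ 2 - s ^ 2)) < 0 := by
  obtain ⟨q, hq⟩ : ∃ q, q = r ^ 2 - s ^ 2 := ⟨_, rfl⟩
  have hs2 : s ^ 2 = r ^ 2 - q := by linarith
  rw [← hq]
  have hq0 : 0 ≤ q := by linarith
  have hP : 0 < a₀ * r ^ 2 := by positivity
  have h1 : α * ν * q ^ 2 ≤ α * n * q ^ 2 := by gcongr
  have h2 : a₀ * s ^ 2 ≤ a * s ^ 2 := by gcongr
  have h3 : (4 * n * k * s + 4 * a + 4 * b * s) * q ≤ C * q := by gcongr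
  have h4 : -(α * ν) * q ^ 2 + (C + 8 * a₀) * q - 8 * (a₀ * r ^ 2) < 0 := by
    by_contra! h
    have h5 := mul_nonneg (by positivity : 0 ≤ 16 * (a₀ * r ^ 2)) h
    have h6 : 16 * (a₀ * r ^ 2) * (-(α * ν) * q ^ 2 + (C + 8 * a₀) * q - 8 * (a₀ * r ^ 2)) =
        -((C + 8 * a₀) * q - 8 * (a₀ * r ^ 2)) ^ 2 - 64 * (a₀ * r ^ 2) ^ 2 := by
      linear_combination (-q ^ 2) * hαν
    nlinarith [sq_nonneg ((C + 8 * a₀) * q - 8 * (a₀ * r ^ 2)), pow_pos hP 2]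
  rw [hs2] at h2 ⊢
  linarith

/-- Strong maximum principle for the degenerate parabolic operator
    `(Lv)(x,t) = n0(x) vₜ - a(x,t) vₓₓ - b(x,t) vₓ` (with `n0 > 0` on `(0,d0)`):
    if `Lv ≤ 0` on `(0,d0) × (0,T]` and `v` attains its maximum over `[0,d0] × [0,T]`
    at an interior point `(x0,t0) ∈ (0,d0) × (0,T]`, then `v ≡ v(x0,t0)` on
    `(0,d0) × (0,t0]`. -/
theorem strong_maximum_principle_degenerate_parabolic
    (B m d0 T : ℝ)
    (hB : 0 < B) (hm : 0 < m) (hd0 : d0 ∈ Set.Ioo (0:ℝ) 1) (hT : 0 < T)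
    (n0 : ℝ → ℝ) (hn0cont : Continuous n0)
    (hn0 : ∀ x ∈ Set.Icc (0:ℝ) d0, 0 ≤ n0 x ∧ n0 x ≤ m)
    (a b : ℝ → ℝ → ℝ)
    (hacont : ContinuousOn (fun p : ℝ × ℝ => a p.1 p.2) (Set.Icc 0 d0 ×ˢ Set.Icc 0 T))
    (hbcont : ContinuousOn (fun p : ℝ × ℝ => b p.1 p.2) (Set.Icc 0 d0 ×ˢ Set.Icc 0 T))
    (ha : ∀ x ∈ Set.Icc (0:ℝ) d0, ∀ t ∈ Set.Icc (0:ℝ) T,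
      1/(2*B) ≤ a x t ∧ a x t ≤ 2*B)
    (hb : ∀ x ∈ Set.Icc (0:ℝ) d0, ∀ t ∈ Set.Icc (0:ℝ) T, |b x t| ≤ 8*B*(m+1))
    (v vx vxx vt : ℝ → ℝ → ℝ)
    (hvx : ∀ x ∈ Set.Ioo (0:ℝ) d0, ∀ t ∈ Set.Ioc (0:ℝ) T,
      HasDerivAt (fun y => v y t) (vx x t) x)
    (hvxx : ∀ x ∈ Set.Ioo (0:ℝ) d0, ∀ t ∈ Set.Ioc (0:ℝ) T,
      HasDerivAt (fun y => vx y t) (vxx x t) x)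
    (hvt : ∀ x ∈ Set.Ioo (0:ℝ) d0, ∀ t ∈ Set.Ioc (0:ℝ) T,
      HasDerivWithinAt (fun s => v x s) (vt x t) (Set.Iic T) t)
    (hvxcont : ContinuousOn (fun p : ℝ × ℝ => vx p.1 p.2) (Set.Ioo 0 d0 ×ˢ Set.Ioc 0 T))
    (hvxxcont : ContinuousOn (fun p : ℝ × ℝ => vxx p.1 p.2) (Set.Ioo 0 d0 ×ˢ Set.Ioc 0 T))
    (hvtcont : ContinuousOn (fun p : ℝ × ℝ => vt p.1 p.2) (Set.Ioo 0 d0 ×ˢ Set.Ioc 0 T))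
    (hvcont : ContinuousOn (fun p : ℝ × ℝ => v p.1 p.2) (Set.Icc 0 d0 ×ˢ Set.Icc 0 T))
    (hLv : ∀ x ∈ Set.Ioo (0:ℝ) d0, ∀ t ∈ Set.Ioc (0:ℝ) T,
      n0 x * vt x t - a x t * vxx x t - b x t * vx x t ≤ 0)
    (hn0pos : ∀ x ∈ Set.Ioo (0:ℝ) d0, 0 < n0 x)
    (x0 t0 : ℝ) (hx0 : x0 ∈ Set.Ioo (0:ℝ) d0) (ht0 : t0 ∈ Set.Ioc (0:ℝ) T)
    (hmax : ∀ x ∈ Set.Icc (0:ℝ) d0, ∀ t ∈ Set.Icc (0:ℝ) T, v x t ≤ v x0 t0) :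
    ∀ x ∈ Set.Ioo (0:ℝ) d0, ∀ t ∈ Set.Ioc (0:ℝ) t0, v x t = v x0 t0 := by
  obtain ⟨hx00, hx0d⟩ := hx0
  obtain ⟨ht00, ht0T⟩ := ht0
  rintro x1 ⟨hx10, hx1d⟩ t' ⟨ht'0, ht't0⟩
  refine le_antisymm (hmax x1 ⟨hx10.le, hx1d.le⟩ t' ⟨ht'0.le, ht't0.trans ht0T⟩) ?_
  by_contra! hlt
  -- Move to a time strictly before `t0`.
  obtain ⟨t1, ht10, ht1t0, hlt1⟩ : ∃ t1, 0 < t1 ∧ t1 < t0 ∧ v x1 t1 < v x0 t0 := by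
    have hc : ContinuousWithinAt (fun s => v x1 s) (Iio t') t' :=
      (hvt x1 ⟨hx10, hx1d⟩ t' ⟨ht'0, ht't0.trans ht0T⟩).continuousWithinAt.mono
        fun s hs => (le_of_lt hs).trans (ht't0.trans ht0T)
    have h1 : ∀ᶠ s in 𝓝[<] t', v x1 s < v x0 t0 := hc.eventually_lt_const hlt
    have h2 : ∀ᶠ s in 𝓝[<] t', 0 < s := eventually_nhdsWithin_of_eventually_nhds
      (lt_mem_nhds ht'0)
    obtain ⟨s, hs1, hs2, hs3⟩ := (h1.and (h2.and self_mem_nhdsWithin)).exists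
    exact ⟨s, hs2, lt_of_lt_of_le hs3 ht't0, hs1⟩
  have ht1T : t1 ≤ T := (ht1t0.trans_le ht0T).le
  -- Radius of the cylinder and lower bound on its bottom.
  obtain ⟨δ, hδ⟩ : ∃ δ, δ = (v x0 t0 - v x1 t1) / 2 := ⟨_, rfl⟩
  have hδ0 : 0 < δ := by linarith
  obtain ⟨r, hr0, hr1, hr2, hr3, hr4, hr5, hbot⟩ : ∃ r > 0, r ≤ 1 ∧ r < x1 ∧ r < d0 - x1 ∧
      r < x0 ∧ r < d0 - x0 ∧ ∀ x, |x - x1| ≤ r → δ ≤ v x0 t0 - v x t1 := by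
    have hc := (hvx x1 ⟨hx10, hx1d⟩ t1 ⟨ht10, ht1T⟩).continuousAt
    have h1 : ∀ᶠ x in 𝓝 x1, v x t1 < v x0 t0 - δ := hc.eventually_lt_const (by linarith)
    obtain ⟨ρ, hρ, hball⟩ := Metric.eventually_nhds_iff.1 h1
    have hm0 : 0 < min (min ρ 1) (min (min x1 (d0 - x1)) (min x0 (d0 - x0))) := by
      simp only [lt_min_iff]
      refine ⟨⟨hρ, one_pos⟩, ⟨hx10, ?_⟩, hx00, ?_⟩ <;> linarith
    obtain ⟨r, hr0, hr⟩ := exists_between hm0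
    simp only [lt_min_iff] at hr
    obtain ⟨⟨h1, h2⟩, ⟨h3, h4⟩, h5, h6⟩ := hr
    refine ⟨r, hr0, h2.le, h3, h4, h5, h6, fun x hx => ?_⟩
    have := hball (y := x) (by rw [Real.dist_eq]; linarith)
    linarith
  obtain ⟨k, hk⟩ : ∃ k, k = (x0 - x1) / (t0 - t1) := ⟨_, rfl⟩
  have hkt : k * (t0 - t1) = x0 - x1 := by
    rw [hk]
    exact div_mul_cancel₀ _ (by linarith)
  have haxis : ∀ t ∈ Icc t1 t0,
      x1 + k * (t - t1) ∈ Icc (min x0 x1) (max x0 x1) := by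
    rintro t ⟨h1, h2⟩
    rcases le_total x0 x1 with h | h
    · have hk0 : k ≤ 0 := by
        rw [hk]; exact div_nonpos_of_nonpos_of_nonneg (by linarith) (by linarith)
      rw [min_eq_left h, max_eq_right h]
      constructor <;> nlinarith
    · have hk0 : 0 ≤ k := by
        rw [hk]; exact div_nonneg (by linarith) (by linarith)
      rw [min_eq_right h, max_eq_left h]
      constructor <;> nlinarith
  have hlo : 0 < min x0 x1 - r := sub_pos.2 (lt_min hr4 hr2)
  have hhi : max x0 x1 + r < d0 := by
    have := max_lt (show x0 < d0 - r by linarith) (show x1 < d0 - r by linarith)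
    linarith
  obtain ⟨ν, hν0, hν⟩ : ∃ ν > 0, ∀ x ∈ Icc (min x0 x1 - r) (max x0 x1 + r), ν ≤ n0 x := by
    obtain ⟨y, hy, hymin⟩ := isCompact_Icc.exists_isMinOn
      (nonempty_Icc.2 (show min x0 x1 - r ≤ max x0 x1 + r by
        linarith [min_le_left x0 x1, le_max_left x0 x1])) hn0cont.continuousOn
    exact ⟨n0 y, hn0pos y ⟨hlo.trans_le hy.1, hy.2.trans_lt hhi⟩, fun x hx => hymin hx⟩
  have htube : ∀ x, ∀ t ∈ Icc t1 t0, |x - (x1 + k * (t - t1))| ≤ r →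
      x ∈ Icc (min x0 x1 - r) (max x0 x1 + r) := by
    intro x t ht hx
    obtain ⟨h1, h2⟩ := haxis t ht
    obtain ⟨h3, h4⟩ := abs_le.1 hx
    constructor <;> linarith
  obtain ⟨C, hC⟩ : ∃ C, C = 4 * (m * |k|) + 8 * B + 4 * (8 * B * (m + 1)) := ⟨_, rfl⟩
  have ha0 : 0 < 1 / (2 * B) := by positivity
  obtain ⟨α, hα0, hα⟩ : ∃ α ≥ 0, 16 * (α * ν) * (1 / (2 * B) * r ^ 2) =
      (C + 8 * (1 / (2 * B))) ^ 2 := by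
    refine ⟨(C + 8 * (1 / (2 * B))) ^ 2 / (16 * ν * (1 / (2 * B) * r ^ 2)), by positivity, ?_⟩
    field_simp
  obtain ⟨K, hK⟩ : ∃ K : Set (ℝ × ℝ), K = (Icc 0 d0 ×ˢ Icc t1 t0) ∩
      {p | |p.1 - (x1 + k * (p.2 - t1))| ≤ r} := ⟨_, rfl⟩
  have hKc : IsCompact K := by
    rw [hK]
    exact (isCompact_Icc.prod isCompact_Icc).inter_right
      (isClosed_le (by fun_prop) continuous_const)
  have hmem : ∀ x t, t ∈ Icc t1 t0 → |x - (x1 + k * (t - t1))| ≤ r → (x, t) ∈ K := by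
    intro x t ht hx
    obtain ⟨h1, h2⟩ := htube x t ht hx
    rw [hK]
    exact ⟨⟨⟨(hlo.trans_le h1).le, (h2.trans_lt hhi).le⟩, ht⟩, hx⟩
  have htop : (x0, t0) ∈ K := by
    refine hmem x0 t0 ⟨ht1t0.le, le_rfl⟩ ?_
    rw [hkt]
    simpa using hr0.le
  have hzc : ContinuousOn
      (fun p : ℝ × ℝ => v x0 t0 - v p.1 p.2 - obliqueBarrier δ α r x1 t1 k p.1 p.2) K := by
    refine (continuousOn_const.sub (hvcont.mono ?_)).sub
      (continuous_obliqueBarrier δ α r x1 t1 k).continuousOn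
    rw [hK]
    rintro p ⟨⟨h1, h2⟩, -⟩
    exact ⟨h1, ht10.le.trans h2.1, h2.2.trans ht0T⟩
  obtain ⟨⟨xs, ts⟩, hsK, hsmin⟩ := hKc.exists_isMinOn ⟨_, htop⟩ hzc
  have hmin : ∀ x t, (x, t) ∈ K →
      v x0 t0 - v xs ts - obliqueBarrier δ α r x1 t1 k xs ts ≤
        v x0 t0 - v x t - obliqueBarrier δ α r x1 t1 k x t := fun x t h => hsmin h
  have hneg : v x0 t0 - v xs ts - obliqueBarrier δ α r x1 t1 k xs ts < 0 := by
    refine (hmin x0 t0 htop).trans_lt ?_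
    have : 0 < obliqueBarrier δ α r x1 t1 k x0 t0 := by
      have h := obliqueBarrier_axis_pos α x1 t1 k t0 hδ0 hr0
      rwa [hkt, add_sub_cancel] at h
    linarith
  obtain ⟨hts, hxs⟩ : ts ∈ Icc t1 t0 ∧ |xs - (x1 + k * (ts - t1))| ≤ r := by
    rw [hK] at hsK
    exact ⟨hsK.1.2, hsK.2⟩
  have htsT : ts ≤ T := hts.2.trans ht0T
  have hts0 : 0 < ts := ht10.trans_le hts.1
  have hxsI := htube xs ts hts hxs
  have hxsd : xs ∈ Ioo 0 d0 := ⟨hlo.trans_le hxsI.1, hxsI.2.trans_lt hhi⟩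
  have hxsc := Ioo_subset_Icc_self hxsd
  -- The negative minimum is neither on the lateral boundary nor on the bottom.
  have hxs' : |xs - (x1 + k * (ts - t1))| < r := by
    refine lt_of_le_of_ne hxs fun heq => hneg.not_ge ?_
    rw [obliqueBarrier_eq_zero α heq]
    linarith [hmax xs hxsc ts ⟨hts0.le, htsT⟩]
  have hts1 : t1 < ts := by
    refine lt_of_le_of_ne hts.1 fun heq => hneg.not_ge ?_
    subst heq
    have hx : |xs - x1| ≤ r := by simpa using hxs
    linarith [hbot xs hx, obliqueBarrier_initial_le (t₁ := t1) (k := k) α hδ0.le hr1 hx]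
  obtain ⟨E, hE⟩ : ∃ E, E = δ * Real.exp (-α * (ts - t1)) := ⟨_, rfl⟩
  have hE0 : 0 < E := by rw [hE]; positivity
  obtain ⟨s, hs⟩ : ∃ s, s = xs - (x1 + k * (ts - t1)) := ⟨_, rfl⟩
  -- First and second order conditions at the minimum.
  have hspace : IsLocalMin
      (fun x => v x0 t0 - v x ts - obliqueBarrier δ α r x1 t1 k x ts) xs := by
    have hc : ContinuousAt (fun x => |x - (x1 + k * (ts - t1))|) xs := by fun_prop
    filter_upwards [hc.eventually_lt_const hxs'] with x hx
    exact hmin x ts (hmem x ts hts hx.le)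
  have hd1 : ∀ x ∈ Ioo 0 d0, HasDerivAt
      (fun x => v x0 t0 - v x ts - obliqueBarrier δ α r x1 t1 k x ts) _ x := fun x hx =>
    ((hvx x hx ts ⟨hts0, htsT⟩).const_sub (v x0 t0)).sub
      (hasDerivAt_obliqueBarrier_space δ α r x1 t1 k x ts)
  have hfirst := hspace.hasDerivAt_eq_zero (hd1 xs hxsd)
  have hsecond := hspace.second_deriv_nonneg
    (eventually_of_mem (isOpen_Ioo.mem_nhds hxsd) hd1)
    ((hvxx xs hxsd ts ⟨hts0, htsT⟩).neg.sub
      (hasDerivAt_obliqueBarrier_space_space δ α r x1 t1 k xs ts))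
  have htime := (((hvt xs hxsd ts ⟨hts0, htsT⟩).mono
    (show Iio ts ⊆ Iic T from fun s hs => (le_of_lt hs).trans htsT)).const_sub (v x0 t0)).sub
      (hasDerivAt_obliqueBarrier_time δ α r x1 t1 k xs ts).hasDerivWithinAt
      |>.nonpos_of_eventually_le_left (by
        have hc : ContinuousAt (fun t => |xs - (x1 + k * (t - t1))|) ts := by fun_prop
        filter_upwards [eventually_nhdsWithin_of_eventually_nhds (hc.eventually_lt_const hxs'),
          eventually_nhdsWithin_of_eventually_nhds (lt_mem_nhds hts1), self_mem_nhdsWithin]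
          with t h1 h2 h3
        exact hmin xs t (hmem xs t ⟨h2.le, (le_of_lt h3).trans hts.2⟩ h1.le))
  rw [← hE, ← hs] at hfirst hsecond htime
  rw [← hs] at hxs
  have hL := hLv xs hxsd ts ⟨hts0, htsT⟩
  obtain ⟨han, haB⟩ := ha xs hxsc ts ⟨hts0.le, htsT⟩
  have hbB := hb xs hxsc ts ⟨hts0.le, htsT⟩
  have hs1 : |s| ≤ 1 := hxs.trans hr1
  have hCs : 4 * n0 xs * k * s + 4 * a xs ts + 4 * b xs ts * s ≤ C := by
    have h1 : n0 xs * k * s ≤ m * |k| := by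
      refine (le_abs_self _).trans ?_
      rw [abs_mul, abs_mul, abs_of_pos (hn0pos xs hxsd)]
      refine (mul_le_of_le_one_right (by have := hn0pos xs hxsd; positivity) hs1).trans ?_
      gcongr
      exact (hn0 xs hxsc).2
    have h2 : b xs ts * s ≤ 8 * B * (m + 1) := by
      refine (le_abs_self _).trans ?_
      rw [abs_mul]
      exact (mul_le_of_le_one_right (abs_nonneg _) hs1).trans hbB
    rw [hC]
    linarith
  have hbar := obliqueBarrier_operator_neg hα0 ha0 hr0 (hν xs hxsI) han
    (sq_le_sq' (abs_le.1 hxs).1 (abs_le.1 hxs).2) hCs hα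
  have hbarE := mul_neg_of_pos_of_neg hE0 hbar
  have hT1 := mul_le_mul_of_nonneg_left htime (hn0pos xs hxsd).le
  have hT2 := mul_nonneg (ha0.le.trans han) hsecond
  have hT3 := congrArg (fun z => b xs ts * z) hfirst
  linarith
end

section
/- Barrier computation for Hopf's lemma (parabolic case): Let ℓ ∈ (0,d0) and t0 ∈ ℝ. There exists α0 > 0, depending only on ℓ, B and m, such that for every α ≥ α0 the function q(x,t) := exp(−α[(x−ℓ)² + (t0−t)]) − exp(−αℓ²) satisfies (Lq)(x,t) = n0(x) ∂ₜq(x,t) − a(x,t) ∂ₓₓq(x,t) − b(x,t) ∂ₓq(x,t) ≤ 0 for all (x,t) with 0 < x < ℓ/2 and 0 < t ≤ T. -/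
open Set

/-- Space derivative of the Gaussian barrier. -/
theorem hasDerivAt_barrier_space (α ℓ c k x : ℝ) :
    HasDerivAt (fun y => Real.exp (-(α * ((y - ℓ)^2 + c))) - k)
      (-(2 * α * (x - ℓ)) * Real.exp (-(α * ((x - ℓ)^2 + c)))) x := by
  have h := (((((((hasDerivAt_id' x).sub_const ℓ).pow 2).add_const c).const_mul
    α).neg).exp).sub_const k
  refine h.congr_deriv ?_
  simp only [Pi.neg_apply, Pi.pow_apply]
  ring

/-- Second space derivative of the Gaussian barrier. -/
theorem deriv_deriv_barrier_space (α ℓ c k x : ℝ) :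
    deriv (fun y => deriv (fun z => Real.exp (-(α * ((z - ℓ)^2 + c))) - k) y) x =
      (4 * α^2 * (x - ℓ)^2 - 2 * α) * Real.exp (-(α * ((x - ℓ)^2 + c))) := by
  simp_rw [fun y => (hasDerivAt_barrier_space α ℓ c k y).deriv]
  have hexp := hasDerivAt_barrier_space α ℓ c 0 x
  simp only [sub_zero] at hexp
  have hlin := (((hasDerivAt_id' x).sub_const ℓ).const_mul (2 * α)).neg
  refine ((hlin.mul hexp).congr_deriv ?_).deriv
  simp only [Pi.neg_apply]
  ring

/-- Time derivative of the Gaussian barrier. -/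
theorem hasDerivAt_barrier_time (α r t0 k t : ℝ) :
    HasDerivAt (fun s => Real.exp (-(α * (r + (t0 - s)))) - k)
      (α * Real.exp (-(α * (r + (t0 - t))))) t := by
  have h := ((((((hasDerivAt_id' t).const_sub t0).const_add r).const_mul
    α).neg).exp).sub_const k
  refine h.congr_deriv ?_
  simp only [Pi.neg_apply]
  ring

/-- Barrier computation for Hopf's lemma (parabolic case): for `ℓ ∈ (0,d0)` and `t0 ∈ ℝ`
    there is `α0 > 0`, depending only on `ℓ`, `B` and `m`, such that for every `α ≥ α0`
    the barrier `q(x,t) = exp(-α[(x-ℓ)² + (t0-t)]) - exp(-αℓ²)` satisfies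
    `(Lq)(x,t) = n0(x) qₜ - a(x,t) qₓₓ - b(x,t) qₓ ≤ 0` on `(0, ℓ/2) × (0,T]`, for every
    choice of coefficients `n0, a, b` obeying the stated bounds. -/
theorem barrier_computation_hopf_parabolic
    (B m d0 T : ℝ)
    (hB : 0 < B) (hm : 0 < m) (hd0 : d0 ∈ Set.Ioo (0:ℝ) 1) (hT : 0 < T)
    (ℓ : ℝ) (hℓ : ℓ ∈ Set.Ioo (0:ℝ) d0) (t0 : ℝ) :
    ∃ α0 > (0:ℝ), ∀ α ≥ α0,
      ∀ n0 : ℝ → ℝ, Continuous n0 →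
      (∀ x ∈ Set.Icc (0:ℝ) d0, 0 ≤ n0 x ∧ n0 x ≤ m) →
      ∀ a b : ℝ → ℝ → ℝ,
      ContinuousOn (fun p : ℝ × ℝ => a p.1 p.2) (Set.Icc 0 d0 ×ˢ Set.Icc 0 T) →
      ContinuousOn (fun p : ℝ × ℝ => b p.1 p.2) (Set.Icc 0 d0 ×ˢ Set.Icc 0 T) →
      (∀ x ∈ Set.Icc (0:ℝ) d0, ∀ t ∈ Set.Icc (0:ℝ) T,
        1/(2*B) ≤ a x t ∧ a x t ≤ 2*B) →
      (∀ x ∈ Set.Icc (0:ℝ) d0, ∀ t ∈ Set.Icc (0:ℝ) T, |b x t| ≤ 8*B*(m+1)) →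
      ∀ x t : ℝ, 0 < x → x < ℓ/2 → 0 < t → t ≤ T →
        n0 x * deriv (fun s => Real.exp (-(α * ((x - ℓ)^2 + (t0 - s)))) -
            Real.exp (-(α * ℓ^2))) t
          - a x t * deriv (fun y => deriv (fun z =>
              Real.exp (-(α * ((z - ℓ)^2 + (t0 - t)))) - Real.exp (-(α * ℓ^2))) y) x
          - b x t * deriv (fun y => Real.exp (-(α * ((y - ℓ)^2 + (t0 - t)))) -
              Real.exp (-(α * ℓ^2))) x ≤ 0 := by
  obtain ⟨hℓ0, hℓd⟩ := hℓ
  set K := m + 4 * B + 16 * B * (m + 1) * ℓ with hK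
  have hKpos : 0 < K := by positivity
  refine ⟨2 * B * K / ℓ^2, by positivity, ?_⟩
  intro α hα n0 _ hn0 a b _ _ ha hb x t hx hxℓ ht htT
  have hαpos : 0 < α := lt_of_lt_of_le (by positivity) hα
  have hxI : x ∈ Set.Icc (0:ℝ) d0 := ⟨hx.le, by linarith⟩
  have htI : t ∈ Set.Icc (0:ℝ) T := ⟨ht.le, htT⟩
  obtain ⟨-, hnm⟩ := hn0 x hxI
  obtain ⟨ha1, ha2⟩ := ha x hxI t htI
  rw [(hasDerivAt_barrier_time α _ t0 _ t).deriv, deriv_deriv_barrier_space,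
    (hasDerivAt_barrier_space α ℓ _ _ x).deriv]
  have hby : b x t * (x - ℓ) ≤ 8 * B * (m + 1) * ℓ := by
    refine (le_abs_self _).trans ?_
    rw [abs_mul]
    exact mul_le_mul (hb x hxI t htI) (abs_le.2 ⟨by linarith, by linarith⟩)
      (abs_nonneg _) (by positivity)
  have hKα : K ≤ 2 * α * (1 / (2 * B) * ℓ^2 / 2) := by
    have h := (div_le_iff₀ (by positivity)).1 hα
    have e : 2 * α * (1 / (2 * B) * ℓ^2 / 2) = α * ℓ^2 / (2 * B) := by
      field_simp
    rw [e, le_div_iff₀ (by positivity)]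
    linarith
  have hay : 1 / (2 * B) * (ℓ^2 / 4) ≤ a x t * (x - ℓ)^2 :=
    mul_le_mul ha1 (by nlinarith) (by positivity)
      (le_trans (by positivity) ha1)
  have hbracket :
      n0 x + 2 * a x t + 2 * (b x t * (x - ℓ)) - 4 * α * (a x t * (x - ℓ)^2) ≤ 0 := by
    have h := mul_le_mul_of_nonneg_left hay (by positivity : 0 ≤ 4 * α)
    linarith
  have hscaled := mul_nonpos_of_nonneg_of_nonpos
    (mul_pos hαpos (Real.exp_pos (-(α * ((x - ℓ)^2 + (t0 - t)))))).le hbracket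
  linarith
end
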